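/- Let C be the extended quaternary quadratic residue code of length 18 and let Aut(C) = {σ ∈ S_18 : permuting the coordinates of every codeword of C by σ again yields a codeword of C}. Then the induced action of Aut(C) on the set of 4-element subsets of {1,…,18} has exactly 4 orbits. -/

import Mathlib

open scoped Classical

noncomputable section

/-- The field with four elements. -/
abbrev F4 := GaloisField 2 2

/-- Membership in the quaternary quadratic residue code of length 17: the codeword, viewed
as the polynomial `∑ cᵢ Xⁱ` modulo `X ^ 17 - 1`, lies in the ideal generated by the
polynomial whose roots are `α ^ ℓ` for `ℓ` running over the nonzero squares mod 17;
equivalently (as that generator is separable and divides `X ^ 17 - 1`), the codeword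
polynomial vanishes at `α ^ ℓ` for every nonzero square `ℓ` modulo 17. -/
def qr4Mem {K : Type} [Field K] [Algebra F4 K] (α : K) (c : Fin 17 → F4) : Prop :=
  ∀ ℓ : ZMod 17, ℓ ≠ 0 → IsSquare ℓ →
    ∑ i : Fin 17, algebraMap F4 K (c i) * α ^ (ℓ.val * (i : ℕ)) = 0

/-- Membership in the extended quaternary quadratic residue code of length 18: the first 17
coordinates form a codeword of the quadratic residue code of length 17 and the last
coordinate is minus the sum of the first 17. -/
def extQR4Mem {K : Type} [Field K] [Algebra F4 K] (α : K) (c : Fin 18 → F4) : Prop :=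
  qr4Mem α (fun i => c i.castSucc) ∧ c (Fin.last 17) = - ∑ i : Fin 17, c i.castSucc

/-- Hamming weight: the number of nonzero coordinates. -/
def wt {n : ℕ} {F : Type} [Zero F] (c : Fin n → F) : ℕ :=
  (Finset.univ.filter fun i => c i ≠ 0).card

/-- Support: the set of nonzero coordinate positions. -/
def supp {n : ℕ} {F : Type} [Zero F] (c : Fin n → F) : Finset (Fin n) :=
  Finset.univ.filter fun i => c i ≠ 0

open Equiv Finset

/-- The nonzero squares modulo 17 (for `b = true`) or the nonsquares (for `b = false`). -/
def residueClass : Bool → Finset (ZMod 17)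
  | true => {1, 2, 4, 8, 9, 13, 15, 16}
  | false => {3, 5, 6, 7, 10, 11, 12, 14}

/-- A parity check matrix over `ZMod 2` of the extended quadratic residue code. -/
def checkMatrix (b : Bool) : Fin 18 → Fin 18 → ZMod 2 :=
  Fin.snoc (α := fun _ => Fin 18 → ZMod 2)
    (fun k : ZMod 17 => Fin.snoc (α := fun _ => ZMod 2)
      (fun j : ZMod 17 => if j - k ∈ residueClass b then 1 else 0) 0)
    (fun _ => 1)

/-- The permutation of the projective line over `ZMod 17` (with `∞` the last point) which adds
one. -/
def translation : Perm (Fin 18) where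
  toFun := Fin.snoc (α := fun _ => Fin 18) (fun i : Fin 17 => (i + 1).castSucc) (Fin.last 17)
  invFun := Fin.snoc (α := fun _ => Fin 18) (fun i : Fin 17 => (i - 1).castSucc) (Fin.last 17)
  left_inv := by decide +kernel
  right_inv := by decide +kernel

/-- Multiplication by `9`, a generator of the group of nonzero squares, on the projective line. -/
def squareScaling : Perm (Fin 18) where
  toFun := Fin.snoc (α := fun _ => Fin 18) (fun i : Fin 17 => (9 * i).castSucc) (Fin.last 17)
  invFun := Fin.snoc (α := fun _ => Fin 18) (fun i : Fin 17 => (2 * i).castSucc) (Fin.last 17)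
  left_inv := by decide +kernel
  right_inv := by decide +kernel

/-- The inversion `x ↦ -1 / x` of the projective line. -/
def inversion : Perm (Fin 18) where
  toFun := Fin.snoc (α := fun _ => Fin 18)
    (fun i : Fin 17 => if i = 0 then Fin.last 17 else (-i ^ 15).castSucc) 0
  invFun := Fin.snoc (α := fun _ => Fin 18)
    (fun i : Fin 17 => if i = 0 then Fin.last 17 else (-i ^ 15).castSucc) 0
  left_inv := by decide +kernel
  right_inv := by decide +kernel

/-- Representatives of the orbits on 4-element subsets. -/
def quadrupleRep : Fin 4 → Finset (Fin 18) :=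
  ![{17, 0, 1, 2}, {17, 0, 1, 3}, {17, 0, 1, 4}, {17, 0, 3, 6}]

lemma checkMatrix_castSucc_castSucc (b : Bool) (k j : ZMod 17) :
    checkMatrix b (Fin.castSucc k) (Fin.castSucc j) = if j - k ∈ residueClass b then 1 else 0 := by
  revert b k j
  decide +kernel

lemma checkMatrix_castSucc_last (b : Bool) (k : ZMod 17) :
    checkMatrix b (Fin.castSucc k) (Fin.last 17) = 0 := by
  revert b k
  decide +kernel

lemma checkMatrix_last (b : Bool) : checkMatrix b (Fin.last 17) = fun _ => 1 :=
  rfl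

lemma checkMatrix_translation (b : Bool) (k j : Fin 18) :
    checkMatrix b k (translation j) = checkMatrix b (translation.symm k) j := by
  revert b k j
  decide +kernel

lemma checkMatrix_squareScaling (b : Bool) (k j : Fin 18) :
    checkMatrix b k (squareScaling j) = checkMatrix b (squareScaling.symm k) j := by
  revert b k j
  decide +kernel

lemma checkMatrix_inversion (b : Bool) (k j : Fin 18) :
    checkMatrix b k (inversion j) =
      if k = 0 then checkMatrix b 0 j
      else if k = Fin.last 17 then 1
      else checkMatrix b 0 j + checkMatrix b (inversion k) j + checkMatrix b 0 k := by
  revert b k j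
  decide +kernel

lemma exists_move_to_zero (x : Fin 18) (hx : x ≠ 17) : ∃ n < 17, (translation ^ n) x = 0 := by
  revert x
  decide +kernel

lemma exists_scaling_eq (x : Fin 18) (hx : x ≠ 17) (hx0 : x ≠ 0) :
    ∃ n < 8, (squareScaling ^ n) x = 1 ∨ (squareScaling ^ n) x = 3 := by
  revert x
  decide +kernel

/-- The permutation `x ↦ 9 ^ d * (a - 1 / (x + c))` of the projective line. -/
def moebius (p : ℕ × ℕ × ℕ) : Perm (Fin 18) :=
  squareScaling ^ p.2.2 * translation ^ p.2.1 * inversion * translation ^ p.1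

/-- Parameters `(c, a, d)` for which `moebius (c, a, d)` maps `{∞, 0, u, y}` to one of the
representatives, for `u = 1` and `u = 3`. -/
def quadrupleMove (u : Fin 18) : Fin 17 → ℕ × ℕ × ℕ :=
  if u = 1 then
    ![(0, 0, 0), (0, 0, 0), (0, 0, 3), (16, 9, 7), (0, 0, 2), (16, 0, 0), (0, 0, 4), (0, 1, 6),
      (0, 1, 0), (0, 0, 4), (16, 16, 4), (0, 1, 0), (0, 10, 7), (0, 0, 4), (16, 0, 6), (0, 8, 3),
      (0, 1, 0)]
  else
    ![(0, 0, 0), (16, 9, 7), (15, 8, 3), (0, 0, 0), (13, 0, 6), (12, 8, 3), (0, 0, 4), (10, 0, 6),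
      (0, 15, 5), (0, 0, 5), (0, 0, 5), (6, 3, 0), (5, 15, 3), (0, 6, 1), (0, 6, 1),
      (0, 8, 1), (1, 0, 2)]

lemma exists_image_eq_quadrupleRep (u : Fin 18) (y : Fin 17) (hu : u = 1 ∨ u = 3)
    (hy : y ≠ 0) (hyu : y.castSucc ≠ u) :
    ∃ i, ({17, 0, u, y.castSucc} : Finset (Fin 18)).image (moebius (quadrupleMove u y)) =
      quadrupleRep i := by
  revert u y
  decide +kernel

/-- The number of 4-element sets disjoint from `T` whose union with `T` is the support of a binary
codeword. -/
def completionCount (b : Bool) (T : Finset (Fin 18)) : ℕ :=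
  #{U ∈ powersetCard 4 Tᶜ |
    ∀ k, ∑ j ∈ T, checkMatrix b k j = ∑ j ∈ U, checkMatrix b k j}

lemma completionCount_quadrupleRep (b : Bool) (i : Fin 4) :
    completionCount b (quadrupleRep i) = if b then ![6, 4, 3, 1] i else ![1, 4, 3, 6] i := by
  revert b i
  decide +kernel

lemma completionCount_quadrupleRep_injective (b : Bool) :
    Function.Injective fun i => completionCount b (quadrupleRep i) := by
  simp only [completionCount_quadrupleRep]
  revert b
  decide

section GaussPeriods

variable {K : Type*} [Field K]

lemma image_mul_residueClass (b : Bool) {d : ZMod 17} (hd : d ∈ residueClass b) :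
    (residueClass true).image (· * d) = residueClass b := by
  revert b d
  decide +kernel

lemma sum_residueClass_mul (f : ZMod 17 → K) (b : Bool) {d : ZMod 17}
    (hd : d ∈ residueClass b) :
    ∑ l ∈ residueClass true, f (l * d) = ∑ x ∈ residueClass b, f x := by
  have hd0 : d ≠ 0 := by
    revert b d
    decide
  have : Fact (Nat.Prime 17) := ⟨by norm_num⟩
  rw [← image_mul_residueClass b hd, sum_image fun _ _ _ _ h => mul_right_cancel₀ hd0 h]

/-- In characteristic two the Gaussian periods of order two modulo 17 are `0` and `1`, so that the
Fourier transform of the set of nonzero squares is again the indicator of a residue class. -/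
lemma exists_sum_addChar_eq_indicator [CharP K 2] {ψ : AddChar (ZMod 17) K}
    (hψ : ψ.IsPrimitive) :
    ∃ b, ∀ d, ∑ l ∈ residueClass true, ψ (l * d) = if d ∈ residueClass b then 1 else 0 := by
  have hzero : ∑ l ∈ residueClass true, ψ (l * 0) = 0 := by
    have h8 : #(residueClass true) = 2 * 4 := by decide
    simp only [mul_zero, AddChar.map_zero_eq_one, sum_const, h8, mul_nsmul, CharTwo.two_nsmul,
      smul_zero]
  have hsq : (∑ x ∈ residueClass true, ψ x) ^ 2 = ∑ x ∈ residueClass true, ψ x := by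
    rw [CharTwo.sum_sq, ← sum_residueClass_mul ψ true (d := 2) (by decide)]
    exact sum_congr rfl fun x _ => by rw [mul_two, AddChar.map_add_eq_mul, sq]
  have hadd : ∑ x ∈ residueClass true, ψ x + ∑ x ∈ residueClass false, ψ x = 1 := by
    have huniv : (univ : Finset (ZMod 17)) =
        insert 0 (residueClass true ∪ residueClass false) := by decide
    have hsum := AddChar.sum_mulShift 1 hψ
    rw [huniv, sum_insert (by decide), sum_union (by decide)] at hsum
    rw [if_neg (by decide), Nat.cast_zero] at hsum
    simp only [mul_one, AddChar.map_zero_eq_one] at hsum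
    exact (CharTwo.add_eq_zero.mp hsum).symm
  have hsplit : ∀ d : ZMod 17, d = 0 ∨ d ∈ residueClass true ∨ d ∈ residueClass false := by
    decide
  have hdisj : ∀ d ∈ residueClass true, d ∉ residueClass false := by decide
  have h0 : ∀ b, (0 : ZMod 17) ∉ residueClass b := by decide
  have h01 : ∑ x ∈ residueClass true, ψ x = 1 ∨ ∑ x ∈ residueClass true, ψ x = 0 := by
    rcases eq_or_ne (∑ x ∈ residueClass true, ψ x) 0 with h | h
    · exact .inr h
    · exact .inl (mul_left_cancel₀ h (by rw [← sq, hsq, mul_one]))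
  rcases h01 with h | h
  · refine ⟨true, fun d => ?_⟩
    rcases hsplit d with rfl | hd | hd
    · rw [hzero, if_neg (h0 true)]
    · rw [sum_residueClass_mul _ _ hd, h, if_pos hd]
    · rw [sum_residueClass_mul _ _ hd, if_neg (fun h => hdisj d h hd)]
      simpa [h] using hadd
  · refine ⟨false, fun d => ?_⟩
    rcases hsplit d with rfl | hd | hd
    · rw [hzero, if_neg (h0 false)]
    · rw [sum_residueClass_mul _ _ hd, h, if_neg (hdisj d hd)]
    · rw [sum_residueClass_mul _ _ hd, if_pos hd]
      simpa [h] using hadd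

/-- Vanishing of the Fourier transform of `a` on the nonzero squares, expressed as a convolution
equation. -/
lemma fourier_vanish_iff [CharP K 2] {ψ : AddChar (ZMod 17) K} (hψ : ψ.IsPrimitive)
    (a : ZMod 17 → K) :
    (∀ l ∈ residueClass true, ∑ i, a i * ψ (l * i) = 0) ↔
      ∀ k, ∑ i, a i * ∑ l ∈ residueClass true, ψ (l * (i - k)) = 0 := by
  constructor
  · intro h k
    calc ∑ i, a i * ∑ l ∈ residueClass true, ψ (l * (i - k))
        = ∑ l ∈ residueClass true, ψ (-(l * k)) * ∑ i, a i * ψ (l * i) := by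
          simp only [mul_sum]
          rw [sum_comm]
          refine sum_congr rfl fun l _ => sum_congr rfl fun i _ => ?_
          rw [mul_sub, sub_eq_add_neg, AddChar.map_add_eq_mul]
          ring
      _ = 0 := sum_eq_zero fun l hl => by rw [h l hl, mul_zero]
  · intro h m hm
    have hone : ((17 : ℕ) : K) = 1 := by
      rw [← Nat.cast_one, CharP.cast_eq_iff_mod_eq K 2]
    calc ∑ i, a i * ψ (m * i)
        = ∑ i, a i * ∑ l ∈ residueClass true, ∑ k, ψ (l * i) * ψ (k * (m - l)) := by
          refine sum_congr rfl fun i _ => ?_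
          simp only [← mul_sum, AddChar.sum_mulShift _ hψ, sub_eq_zero, ZMod.card]
          rw [sum_eq_single_of_mem m hm fun l _ hl => by rw [if_neg hl.symm]; simp]
          rw [if_pos rfl, hone, mul_one]
      _ = ∑ k, ψ (m * k) * ∑ i, a i * ∑ l ∈ residueClass true, ψ (l * (i - k)) := by
          simp only [mul_sum]
          conv_rhs => rw [sum_comm]
          refine sum_congr rfl fun i _ => ?_
          rw [sum_comm]
          refine sum_congr rfl fun k _ => sum_congr rfl fun l _ => ?_
          rw [mul_left_comm (ψ (m * k)), ← AddChar.map_add_eq_mul, ← AddChar.map_add_eq_mul]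
          congr 2
          ring
      _ = 0 := sum_eq_zero fun k _ => by rw [h k, mul_zero]

end GaussPeriods

/-- The linear code over `F4` with parity check matrix `checkMatrix b`. -/
def IsCodeword (b : Bool) (c : Fin 18 → F4) : Prop :=
  ∀ k, ∑ j, checkMatrix b k j • c j = 0

lemma exists_extQR4Mem_iff_isCodeword {K : Type} [Field K] [Algebra F4 K] {α : K}
    (hα : IsPrimitiveRoot α 17) : ∃ b, ∀ c, extQR4Mem α c ↔ IsCodeword b c := by
  have : CharP K 2 := charP_of_injective_algebraMap (algebraMap F4 K).injective 2
  have hψ : (AddChar.zmodChar 17 hα.pow_eq_one).IsPrimitive :=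
    AddChar.zmodChar_primitive_of_primitive_root 17 hα
  obtain ⟨b, hb⟩ := exists_sum_addChar_eq_indicator hψ
  refine ⟨b, fun c => ?_⟩
  have hsquare : ∀ l : ZMod 17, l ≠ 0 ∧ IsSquare l ↔ l ∈ residueClass true := by decide
  have hpow (l i : ZMod 17) :
      α ^ (l.val * i.val) = AddChar.zmodChar 17 hα.pow_eq_one (l * i) := by
    rw [pow_mul, ← AddChar.zmodChar_apply hα.pow_eq_one, ← AddChar.map_nsmul_eq_pow, nsmul_eq_mul,
      mul_comm]
    congr 2
    exact ZMod.natCast_zmod_val i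
  have hqr : qr4Mem α (fun i => c i.castSucc) ↔
      ∀ k : Fin 17, ∑ j, checkMatrix b k.castSucc j • c j = 0 := by
    calc qr4Mem α (fun i => c i.castSucc)
        ↔ ∀ l ∈ residueClass true, ∑ i : ZMod 17, algebraMap F4 K (c (Fin.castSucc i)) *
            AddChar.zmodChar 17 hα.pow_eq_one (l * i) = 0 := by
          simp only [← hsquare, and_imp, ← hpow]
          rfl
      _ ↔ _ := fourier_vanish_iff hψ _
      _ ↔ _ := by
          refine forall_congr' fun k => ?_
          rw [← map_eq_zero (algebraMap F4 K), map_sum, Fin.sum_univ_castSucc (n := 17),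
            checkMatrix_castSucc_last, zero_smul, map_zero, add_zero]
          refine Eq.congr_left (sum_congr rfl fun j _ => ?_)
          rw [hb, checkMatrix_castSucc_castSucc]
          split_ifs <;> simp
  rw [extQR4Mem, hqr, IsCodeword, Fin.forall_fin_succ' (n := 17)]
  refine and_congr_right fun _ => ?_
  rw [CharTwo.neg_eq, ← CharTwo.add_eq_zero, add_comm, ← Fin.sum_univ_castSucc (n := 17),
    checkMatrix_last]
  simp only [one_smul]

/-- The group of coordinate permutations preserving the code with parity check matrix
`checkMatrix b`. -/
def codeAut (b : Bool) : Subgroup (Perm (Fin 18)) :=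
  let S : Submonoid (Perm (Fin 18)) :=
    { carrier := {σ | ∀ c, IsCodeword b c → IsCodeword b (c ∘ σ)}
      one_mem' := fun c hc => by rwa [Perm.coe_one, Function.comp_id]
      mul_mem' := fun hσ hτ c hc => by
        rw [Perm.coe_mul, ← Function.comp_assoc]
        exact hτ _ (hσ c hc) }
  { S with
    inv_mem' := fun {σ} hσ => by
      obtain ⟨n, hn⟩ := mem_powers_iff_mem_zpowers.mpr
        (inv_mem (Subgroup.mem_zpowers σ))
      have hpow : σ ^ n ∈ S := S.pow_mem hσ n
      exact hn ▸ hpow }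

lemma mem_codeAut {b : Bool} {σ : Perm (Fin 18)} :
    σ ∈ codeAut b ↔ ∀ c, IsCodeword b c → IsCodeword b (c ∘ σ) :=
  Iff.rfl

lemma mem_codeAut_of_rows {b : Bool} {σ : Perm (Fin 18)}
    (h : ∀ k, (fun j => checkMatrix b k (σ j)) ∈
      Submodule.span (ZMod 2) (Set.range (checkMatrix b))) : σ ∈ codeAut b := by
  rw [← inv_mem_iff, mem_codeAut]
  intro c hc k
  have key : ∀ r ∈ Submodule.span (ZMod 2) (Set.range (checkMatrix b)), ∑ j, r j • c j = 0 := by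
    intro r hr
    induction hr using Submodule.span_induction with
    | mem r hr =>
      obtain ⟨l, rfl⟩ := hr
      exact hc l
    | zero => simp
    | add r s _ _ hr hs => simp only [Pi.add_apply, add_smul, sum_add_distrib, hr, hs, add_zero]
    | smul a r _ hr => simp only [Pi.smul_apply, smul_assoc, ← smul_sum, hr, smul_zero]
  rw [← key _ (h k), ← Equiv.sum_comp σ]
  exact sum_congr rfl fun j _ => by rw [Function.comp_apply, Perm.inv_def, symm_apply_apply]

lemma translation_mem_codeAut (b : Bool) : translation ∈ codeAut b :=
  mem_codeAut_of_rows fun k => Submodule.subset_span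
    ⟨translation.symm k, funext fun j => (checkMatrix_translation b k j).symm⟩

lemma squareScaling_mem_codeAut (b : Bool) : squareScaling ∈ codeAut b :=
  mem_codeAut_of_rows fun k => Submodule.subset_span
    ⟨squareScaling.symm k, funext fun j => (checkMatrix_squareScaling b k j).symm⟩

lemma inversion_mem_codeAut (b : Bool) : inversion ∈ codeAut b := by
  refine mem_codeAut_of_rows fun k => ?_
  have hrow (l) : checkMatrix b l ∈ Submodule.span (ZMod 2) (Set.range (checkMatrix b)) :=
    Submodule.subset_span ⟨l, rfl⟩
  simp only [checkMatrix_inversion]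
  split_ifs
  · exact hrow 0
  · exact checkMatrix_last b ▸ hrow (Fin.last 17)
  · convert add_mem (add_mem (hrow 0) (hrow (inversion k)))
      (Submodule.smul_mem _ (checkMatrix b 0 k) (hrow (Fin.last 17))) using 1
    rw [checkMatrix_last]
    ext j
    simp

lemma moebius_mem_codeAut (b : Bool) (p : ℕ × ℕ × ℕ) : moebius p ∈ codeAut b :=
  mul_mem (mul_mem (mul_mem (pow_mem (squareScaling_mem_codeAut b) _)
    (pow_mem (translation_mem_codeAut b) _)) (inversion_mem_codeAut b))
    (pow_mem (translation_mem_codeAut b) _)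

lemma isCodeword_indicator_iff {b : Bool} {T U : Finset (Fin 18)} (h : Disjoint T U) :
    IsCodeword b (fun j => if j ∈ T ∪ U then 1 else 0) ↔
      ∀ k, ∑ j ∈ T, checkMatrix b k j = ∑ j ∈ U, checkMatrix b k j := by
  refine forall_congr' fun k => ?_
  simp only [smul_ite, smul_zero, sum_ite_mem, univ_inter, ← sum_smul]
  rw [smul_eq_zero_iff_left one_ne_zero, sum_union h, CharTwo.add_eq_zero]

lemma completionCount_image_le {b : Bool} {σ : Perm (Fin 18)} (hσ : σ ∈ codeAut b)
    (T : Finset (Fin 18)) : completionCount b (T.image σ) ≤ completionCount b T := by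
  refine card_le_card_of_injOn (fun U => U.image σ.symm) ?_
    (image_injective σ.symm.injective).injOn
  intro U hU
  simp only [coe_filter, mem_powersetCard, Set.mem_ofPred_eq] at hU ⊢
  obtain ⟨⟨hUT, hcard⟩, hU⟩ := hU
  rw [subset_compl_iff_disjoint_left] at hUT ⊢
  have hdisj : Disjoint T (U.image σ.symm) := by
    rw [← disjoint_image σ.injective, image_image]
    simpa using hUT
  refine ⟨⟨hdisj, by rw [card_image_of_injective _ σ.symm.injective, hcard]⟩, ?_⟩
  rw [← isCodeword_indicator_iff hUT] at hU
  rw [← isCodeword_indicator_iff hdisj]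
  have hinv (j : Fin 18) : (∃ a ∈ U, j = σ.symm a) ↔ σ j ∈ U := by
    simp [Equiv.eq_symm_apply]
  convert hσ _ hU using 2 with j
  simp [mem_image, eq_comm, hinv]

lemma completionCount_image {b : Bool} {σ : Perm (Fin 18)} (hσ : σ ∈ codeAut b)
    (T : Finset (Fin 18)) : completionCount b (T.image σ) = completionCount b T := by
  refine (completionCount_image_le hσ T).antisymm ?_
  simpa [image_image, Function.comp_def] using completionCount_image_le (inv_mem hσ) (T.image σ)

/-- Möbius transformations, which are automorphisms of the code, move any 4-element set to one of the
representatives. -/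
lemma exists_image_quadruple_eq (b : Bool) {T : Finset (Fin 18)} (hT : #T = 4) :
    ∃ σ ∈ codeAut b, ∃ i, T.image σ = quadrupleRep i := by
  obtain ⟨p, q, r, s, hpq, hpr, hps, hqr, hqs, hrs, rfl⟩ := card_eq_four.mp hT
  obtain ⟨σ₁, hσ₁, h₁⟩ : ∃ σ ∈ codeAut b, σ p = 17 := by
    rcases eq_or_ne p 17 with rfl | hp
    · exact ⟨1, one_mem _, rfl⟩
    · obtain ⟨n, -, hn⟩ := exists_move_to_zero p hp
      refine ⟨inversion * translation ^ n, mul_mem (inversion_mem_codeAut b)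
        (pow_mem (translation_mem_codeAut b) n), ?_⟩
      rw [Perm.mul_apply, hn]
      decide
  obtain ⟨n, -, hn⟩ := exists_move_to_zero (σ₁ q) (h₁ ▸ σ₁.injective.ne hpq.symm)
  have hfix : (translation ^ n) 17 = 17 :=
    Function.IsFixedPt.perm_pow (e := translation) (by decide) n
  obtain ⟨σ₂, hσ₂, h₂p, h₂q⟩ : ∃ σ ∈ codeAut b, σ p = 17 ∧ σ q = 0 :=
    ⟨translation ^ n * σ₁, mul_mem (pow_mem (translation_mem_codeAut b) n) hσ₁, by simp [h₁, hfix],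
      by simp [hn]⟩
  obtain ⟨m, -, hm⟩ := exists_scaling_eq (σ₂ r) (h₂p ▸ σ₂.injective.ne hpr.symm)
    (h₂q ▸ σ₂.injective.ne hqr.symm)
  have hfix' (x) (hx : squareScaling x = x) : (squareScaling ^ m) x = x :=
    Function.IsFixedPt.perm_pow hx m
  obtain ⟨σ₃, hσ₃, h₃p, h₃q, h₃r⟩ : ∃ σ ∈ codeAut b, σ p = 17 ∧ σ q = 0 ∧ (σ r = 1 ∨ σ r = 3) :=
    ⟨squareScaling ^ m * σ₂, mul_mem (pow_mem (squareScaling_mem_codeAut b) m) hσ₂,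
      by rw [Perm.mul_apply, h₂p, hfix' _ (by decide)],
      by rw [Perm.mul_apply, h₂q, hfix' _ (by decide)], hm⟩
  obtain ⟨y, hy⟩ : ∃ y : Fin 17, y.castSucc = σ₃ s :=
    Fin.exists_castSucc_eq.mpr fun h => hps (σ₃.injective (h₃p.trans h.symm))
  obtain ⟨i, hi⟩ := exists_image_eq_quadrupleRep (σ₃ r) y h₃r
    (fun h => σ₃.injective.ne hqs (by rw [← hy, h, h₃q]; rfl)) (hy ▸ σ₃.injective.ne hrs.symm)
  refine ⟨moebius (quadrupleMove (σ₃ r) y) * σ₃, mul_mem (moebius_mem_codeAut b _) hσ₃, i, ?_⟩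
  rw [Perm.coe_mul, ← image_image, ← hi]
  simp only [image_insert, image_singleton, h₃p, h₃q, hy]

/-- The automorphism group of the extended quaternary quadratic residue code `C` of length
18 (all coordinate permutations sending codewords to codewords) acts on the 4-element
subsets of `{1, …, 18}` with exactly 4 orbits. -/
theorem quaternary_aut_orbits_on_quadruples (K : Type) [Field K] [Algebra F4 K] (α : K)
    (hα : IsPrimitiveRoot α 17) :
    {O : Set (Finset (Fin 18)) | ∃ T : Finset (Fin 18), T.card = 4 ∧
      O = {T' | ∃ σ : Equiv.Perm (Fin 18),
        (∀ c : Fin 18 → F4, extQR4Mem α c → extQR4Mem α (c ∘ σ)) ∧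
        T.image σ = T'}}.ncard = 4 := by
  obtain ⟨b, hb⟩ := exists_extQR4Mem_iff_isCodeword hα
  simp only [hb, ← mem_codeAut]
  have hrange : {O : Set (Finset (Fin 18)) | ∃ T : Finset (Fin 18), T.card = 4 ∧
      O = {T' | ∃ σ ∈ codeAut b, T.image σ = T'}} =
      Set.range fun i => {T' | ∃ σ ∈ codeAut b, (quadrupleRep i).image σ = T'} := by
    ext O
    constructor
    · rintro ⟨T, hT, rfl⟩
      obtain ⟨σ, hσ, i, hi⟩ := exists_image_quadruple_eq b hT
      refine ⟨i, Set.ext fun T' => ⟨?_, ?_⟩⟩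
      · rintro ⟨τ, hτ, rfl⟩
        exact ⟨τ * σ, mul_mem hτ hσ, by rw [Perm.coe_mul, ← image_image, hi]⟩
      · rintro ⟨τ, hτ, rfl⟩
        refine ⟨τ * σ⁻¹, mul_mem hτ (inv_mem hσ), ?_⟩
        rw [← hi, image_image, ← Perm.coe_mul, inv_mul_cancel_right]
    · rintro ⟨i, rfl⟩
      exact ⟨quadrupleRep i, by revert i; decide, rfl⟩
  have hinj : Function.Injective fun i =>
      {T' | ∃ σ ∈ codeAut b, (quadrupleRep i).image σ = T'} := by
    intro i j hij
    have hmem : quadrupleRep i ∈ {T' | ∃ σ ∈ codeAut b, (quadrupleRep i).image σ = T'} :=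
      ⟨1, one_mem _, image_id⟩
    obtain ⟨σ, hσ, h⟩ := Set.ext_iff.mp hij _ |>.mp hmem
    refine completionCount_quadrupleRep_injective b ?_
    simp only [← h, completionCount_image hσ]
  rw [hrange, Set.ncard_range_of_injective hinj, Nat.card_fin]
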